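/- arXiv:1912.07993 — 2 statements merged into one kernel-verified Lean document; each statement's English description precedes it below -/
import Mathlib

section
/- Let K ⊆ ℝⁿ be a convex body with nonempty interior. Then (8^{n/2} vol(K))^{1/2} ≤ W(K) ≤ 8^{n/2} vol(K) / sup_{y∈ℝⁿ} γₙ(y + √(2π)·K), where γₙ is the standard Gaussian probability measure on ℝⁿ and √(2π)·K denotes the dilation of K by the factor √(2π). -/
open scoped Pointwise
open MeasureTheory Metric Real

/-- The Wills functional `W(K) = ∫_{ℝⁿ} e^{-π d(x,K)²} dx`. -/
noncomputable def wills {n : ℕ} (K : Set (EuclideanSpace ℝ (Fin n))) : ℝ :=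
  ∫ x, Real.exp (-π * (Metric.infDist x K) ^ 2)

open scoped ENNReal

lemma bm1_compact {A B C : Set ℝ} (hA : IsCompact A) (hB : IsCompact B) (hA0 : A.Nonempty)
    (hB0 : B.Nonempty) (h : ∀ a ∈ A, ∀ b ∈ B, a + b ∈ C) :
    volume A + volume B ≤ volume C := by
  obtain ⟨M, hM, hM'⟩ := hA.exists_isGreatest hA0
  obtain ⟨m, hm, hm'⟩ := hB.exists_isLeast hB0
  have h1 : volume ((fun x => x + (-m)) ⁻¹' A) = volume A := measure_preimage_add_right _ _ _
  have h2 : volume ((fun x => x + (-M)) ⁻¹' B) = volume B := measure_preimage_add_right _ _ _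
  rw [← h1, ← h2, ← measure_union₀]
  · apply measure_mono
    rintro x (hx | hx)
    · have := h _ hx _ hm
      simpa using this
    · have := h _ hM _ hx
      simpa using this
  · exact ((measurable_add_const (-M)) hB.measurableSet).nullMeasurableSet
  · apply measure_mono_null (t := {M + m}) _ (by simp)
    rintro x ⟨hx, hx'⟩
    have h3 := hM' hx
    have h4 := hm' hx'
    simp only [Set.mem_singleton_iff]
    linarith

lemma bm1 {A B C : Set ℝ} (hA : MeasurableSet A) (hB : MeasurableSet B) (hA0 : A.Nonempty)
    (hB0 : B.Nonempty) (h : ∀ a ∈ A, ∀ b ∈ B, a + b ∈ C) :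
    volume A + volume B ≤ volume C := by
  obtain ⟨a0, ha0⟩ := hA0
  obtain ⟨b0, hb0⟩ := hB0
  have key : ∀ K, K ⊆ A → IsCompact K → ∀ L, L ⊆ B → IsCompact L →
      volume K + volume L ≤ volume C := by
    intro K hK hKc L hL hLc
    refine le_trans (add_le_add (measure_mono (Set.subset_insert a0 K))
      (measure_mono (Set.subset_insert b0 L))) ?_
    apply bm1_compact (hKc.insert a0) (hLc.insert b0) (Set.insert_nonempty _ _)
      (Set.insert_nonempty _ _)
    rintro a (rfl | ha) b (rfl | hb)
    · exact h _ ha0 _ hb0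
    · exact h _ ha0 _ (hL hb)
    · exact h _ (hK ha) _ hb0
    · exact h _ (hK ha) _ (hL hb)
  rw [hA.measure_eq_iSup_isCompact, hB.measure_eq_iSup_isCompact]
  simp only [iSup_and']
  apply ENNReal.biSup_add_biSup_le (s := {K | K ⊆ A ∧ IsCompact K})
    (t := {L | L ⊆ B ∧ IsCompact L})
  · exact ⟨∅, Set.empty_subset _, isCompact_empty⟩
  · exact ⟨∅, Set.empty_subset _, isCompact_empty⟩
  · rintro K ⟨h1, h2⟩ L ⟨h3, h4⟩
    exact key K h1 h2 L h3 h4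

lemma pl_norm {f g h : ℝ → ℝ} (hf : Measurable f) (hg : Measurable g) (hh : Measurable h)
    (f0 : ∀ x, 0 ≤ f x) (g0 : ∀ x, 0 ≤ g x) (h0 : ∀ x, 0 ≤ h x)
    (f1 : ∀ x, f x ≤ 1) (g1 : ∀ x, g x ≤ 1)
    (fs : ∀ t, 0 < t → t < 1 → ∃ x, t < f x) (gs : ∀ t, 0 < t → t < 1 → ∃ x, t < g x)
    (H : ∀ x y, f x * g y ≤ h ((1 / 2 : ℝ) * (x + y)) ^ 2) :
    (∫⁻ x, ENNReal.ofReal (f x)) + (∫⁻ x, ENNReal.ofReal (g x)) ≤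
      2 * ∫⁻ x, ENNReal.ofReal (h x) := by
  rw [lintegral_eq_lintegral_meas_lt _ (Filter.Eventually.of_forall f0) hf.aemeasurable,
    lintegral_eq_lintegral_meas_lt _ (Filter.Eventually.of_forall g0) hg.aemeasurable,
    lintegral_eq_lintegral_meas_lt _ (Filter.Eventually.of_forall h0) hh.aemeasurable,
    ← lintegral_const_mul' _ _ (by simp), ← lintegral_add_left]
  · apply setLIntegral_mono' measurableSet_Ioi
    intro t ht
    have ht : 0 < t := ht
    rcases lt_or_ge t 1 with h1 | h1
    · have e : (2 : ℝ≥0∞) * volume {a | t < h a} = volume ((fun x => (1/2 : ℝ) * x) ⁻¹' {a | t < h a}) := by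
        rw [Real.volume_preimage_mul_left (by norm_num)]
        norm_num
      rw [e]
      apply bm1 (hf measurableSet_Ioi) (hg measurableSet_Ioi) (fs t ht h1) (gs t ht h1)
      intro a ha b hb
      have ha : t < f a := ha
      have hb : t < g b := hb
      show t < h _
      have := H a b
      have h3 : t * t < f a * g b := by nlinarith
      nlinarith [h0 ((1/2 : ℝ) * (a + b))]
    · have e1 : {a | t < f a} = ∅ := by
        ext x; simp; linarith [f1 x]
      have e2 : {a | t < g a} = ∅ := by
        ext x; simp; linarith [g1 x]
      simp [e1, e2]
  · have : Antitone (fun t : ℝ => volume {a | t < f a}) := by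
      intro s t hst
      apply measure_mono
      intro x hx
      exact lt_of_le_of_lt hst hx
    exact this.measurable

lemma four_mul_le (x y : ℝ≥0∞) : 4 * (x * y) ≤ (x + y) ^ 2 := by
  wlog hxy : x ≤ y generalizing x y
  · rw [mul_comm x, add_comm]; exact this y x (le_of_not_ge hxy)
  obtain ⟨c, rfl⟩ := exists_add_of_le hxy
  calc 4 * (x * (x + c)) ≤ 4 * (x * (x + c)) + c ^ 2 := le_self_add
    _ = _ := by ring

def PL (E : Type*) [AddCommGroup E] [Module ℝ E] [MeasurableSpace E] (μ : Measure E) : Prop :=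
  ∀ f g h : E → ℝ≥0∞, Measurable f → Measurable g → Measurable h →
    (∀ x y, f x * g y ≤ h ((1 / 2 : ℝ) • (x + y)) ^ 2) →
    (∫⁻ x, f x ∂μ) * (∫⁻ x, g x ∂μ) ≤ (∫⁻ x, h x ∂μ) ^ 2

lemma pl_bdd {f g h : ℝ → ℝ≥0∞} (hf : Measurable f) (hg : Measurable g) (hh : Measurable h)
    (N : ℝ≥0∞) (hN : N ≠ ∞) (fN : ∀ x, f x ≤ N) (gN : ∀ x, g x ≤ N) (hN' : ∀ x, h x ≤ N)
    (H : ∀ x y, f x * g y ≤ h ((1 / 2 : ℝ) * (x + y)) ^ 2) :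
    (∫⁻ x, f x) * (∫⁻ x, g x) ≤ (∫⁻ x, h x) ^ 2 := by
  set a := ⨆ x, f x with ha
  set b := ⨆ x, g x with hb
  have fa : ∀ x, f x ≤ a := le_iSup f
  have gb : ∀ x, g x ≤ b := le_iSup g
  have aN : a ≠ ∞ := ne_top_of_le_ne_top hN (iSup_le fN)
  have bN : b ≠ ∞ := ne_top_of_le_ne_top hN (iSup_le gN)
  by_cases a0 : a = 0
  · have : ∀ x, f x = 0 := fun x => le_antisymm (a0 ▸ fa x) bot_le
    simp [this]
  by_cases b0 : b = 0
  · have : ∀ x, g x = 0 := fun x => le_antisymm (b0 ▸ gb x) bot_le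
    simp [this]
  have ap : 0 < a.toReal := ENNReal.toReal_pos a0 aN
  have bp : 0 < b.toReal := ENNReal.toReal_pos b0 bN
  set s := √(a.toReal * b.toReal) with hs
  have sp : 0 < s := by positivity
  have s2 : s ^ 2 = a.toReal * b.toReal := Real.sq_sqrt (by positivity)
  have fint : ∀ x, f x ≠ ∞ := fun x => ne_top_of_le_ne_top hN (fN x)
  have gint : ∀ x, g x ≠ ∞ := fun x => ne_top_of_le_ne_top hN (gN x)
  have hint : ∀ x, h x ≠ ∞ := fun x => ne_top_of_le_ne_top hN (hN' x)
  have conv : ∀ (u : ℝ → ℝ≥0∞) (c : ℝ), Measurable u → (∀ x, u x ≠ ∞) → 0 < c →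
      ∫⁻ x, u x = ENNReal.ofReal c * ∫⁻ x, ENNReal.ofReal ((u x).toReal / c) := by
    intro u c hu hu' hc
    rw [← lintegral_const_mul' _ _ (by simp)]
    congr 1; ext x
    rw [← ENNReal.ofReal_mul hc.le, mul_div_cancel₀ _ hc.ne', ENNReal.ofReal_toReal (hu' x)]
  have sups : ∀ (u : ℝ → ℝ≥0∞) (c : ℝ≥0∞), c ≤ ⨆ x, u x → c ≠ ∞ → 0 < c.toReal →
      (∀ x, u x ≠ ∞) → ∀ t : ℝ, 0 < t → t < 1 → ∃ x, t < (u x).toReal / c.toReal := by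
    intro u c hc hc' cp hu t t0 t1
    have : ENNReal.ofReal (t * c.toReal) < c := by
      rw [ENNReal.ofReal_lt_iff_lt_toReal (by positivity) hc']
      nlinarith
    obtain ⟨x, hx⟩ := lt_iSup_iff.1 (this.trans_le hc)
    refine ⟨x, ?_⟩
    rw [lt_div_iff₀ cp]
    exact (ENNReal.ofReal_lt_iff_lt_toReal (by positivity) (hu x)).1 hx
  have key := pl_norm (f := fun x => (f x).toReal / a.toReal) (g := fun x => (g x).toReal / b.toReal)
    (h := fun x => (h x).toReal / s) (by fun_prop) (by fun_prop) (by fun_prop)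
    (fun x => by positivity) (fun x => by positivity) (fun x => by positivity)
    (fun x => by
      rw [div_le_one ap]; exact ENNReal.toReal_mono aN (fa x))
    (fun x => by
      rw [div_le_one bp]; exact ENNReal.toReal_mono bN (gb x))
    (sups f a ha.le aN ap fint) (sups g b hb.le bN bp gint)
    (fun x y => by
      have := ENNReal.toReal_mono (by simp [hint]) (H x y)
      rw [ENNReal.toReal_mul, ENNReal.toReal_pow] at this
      rw [div_mul_div_comm, div_pow, s2]
      gcongr)
  rw [conv f _ hf fint ap, conv g _ hg gint bp, conv h _ hh hint sp]
  set I := ∫⁻ x, ENNReal.ofReal ((f x).toReal / a.toReal)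
  set J := ∫⁻ x, ENNReal.ofReal ((g x).toReal / b.toReal)
  set L := ∫⁻ x, ENNReal.ofReal ((h x).toReal / s)
  have h4 : I * J ≤ L ^ 2 := by
    have h5 : 4 * (I * J) ≤ 4 * L ^ 2 := by
      refine (four_mul_le I J).trans ((pow_le_pow_left' key 2).trans (le_of_eq ?_))
      ring
    exact (ENNReal.mul_le_mul_iff_right (by simp) (by simp)).1 h5
  rw [mul_pow, ← ENNReal.ofReal_pow sp.le, s2, ENNReal.ofReal_mul ap.le]
  calc _ = ENNReal.ofReal a.toReal * ENNReal.ofReal b.toReal * (I * J) := by ring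
    _ ≤ _ := by gcongr

lemma pl_real : PL ℝ volume := by
  intro f g h hf hg hh H
  have tr : ∀ u : ℝ → ℝ≥0∞, Measurable u →
      ∫⁻ x, u x = ⨆ N : ℕ, ∫⁻ x, min (u x) N := by
    intro u hu
    rw [← lintegral_iSup]
    · congr 1; ext x
      rw [← inf_iSup_eq, ENNReal.iSup_natCast, inf_top_eq]
    · intro N; fun_prop
    · intro N M hNM x
      dsimp
      gcongr
  have mono : ∀ u : ℝ → ℝ≥0∞, Monotone fun N : ℕ => ∫⁻ x, min (u x) N := by
    intro u N M hNM
    dsimp only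
    gcongr
  rw [tr f hf, tr g hg, ENNReal.iSup_mul]
  apply iSup_le
  intro N1
  rw [ENNReal.mul_iSup]
  apply iSup_le
  intro N2
  set N := max N1 N2
  refine (mul_le_mul' (mono f (le_max_left N1 N2)) (mono g (le_max_right N1 N2))).trans ?_
  refine (pl_bdd (h := fun x => min (h x) N) (hf.min measurable_const) (hg.min measurable_const) (hh.min measurable_const)
    N (by simp) (fun x => min_le_right _ _) (fun x => min_le_right _ _) (fun x => min_le_right _ _)
    ?_).trans ?_
  · intro x y
    rcases min_cases (h ((1 / 2 : ℝ) * (x + y))) (N : ℝ≥0∞) with ⟨h1, _⟩ | ⟨h1, _⟩ <;> rw [h1]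
    · exact le_trans (mul_le_mul' (min_le_left _ _) (min_le_left _ _)) (H x y)
    · rw [sq]; exact (mul_le_mul' (min_le_right _ _) (min_le_right _ _))
  · gcongr; exact min_le_left _ _

lemma PL.prod {E F : Type*} [AddCommGroup E] [Module ℝ E] [MeasurableSpace E] {μ : Measure E}
    [AddCommGroup F] [Module ℝ F] [MeasurableSpace F] {ν : Measure F} [SFinite μ] [SFinite ν]
    (hE : PL E μ) (hF : PL F ν) : PL (E × F) (μ.prod ν) := by
  intro f g h hf hg hh H
  rw [lintegral_prod _ hf.aemeasurable, lintegral_prod _ hg.aemeasurable,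
    lintegral_prod _ hh.aemeasurable]
  apply hE
  · exact hf.lintegral_prod_right'
  · exact hg.lintegral_prod_right'
  · exact hh.lintegral_prod_right'
  intro x x'
  apply hF
  · exact hf.comp measurable_prodMk_left
  · exact hg.comp measurable_prodMk_left
  · exact hh.comp measurable_prodMk_left
  intro y y'
  exact H (x, y) (x', y')

lemma PL.map {E F : Type*} [AddCommGroup E] [Module ℝ E] [MeasurableSpace E] {μ : Measure E}
    [AddCommGroup F] [Module ℝ F] [MeasurableSpace F] {ν : Measure F}
    (hE : PL E μ) (e : E → F) (he : MeasurePreserving e μ ν)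
    (hl : ∀ x y, e ((1 / 2 : ℝ) • (x + y)) = (1 / 2 : ℝ) • (e x + e y)) : PL F ν := by
  intro f g h hf hg hh H
  rw [← he.lintegral_comp hf, ← he.lintegral_comp hg, ← he.lintegral_comp hh]
  apply hE _ _ _ (hf.comp he.measurable) (hg.comp he.measurable) (hh.comp he.measurable)
  intro x y
  simp only [Function.comp, hl]
  exact H _ _

lemma pl_pi (n : ℕ) : PL (Fin n → ℝ) volume := by
  induction n with
  | zero =>
    intro f g h hf hg hh H
    rw [MeasureTheory.Measure.volume_pi_eq_dirac 0]
    simp only [lintegral_dirac]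
    simpa using H 0 0
  | succ n ih =>
    refine (pl_real.prod ih).map _
      (volume_preserving_piFinSuccAbove (fun _ : Fin (n + 1) => ℝ) 0).symm ?_
    intro x y
    ext i
    refine Fin.cases ?_ (fun i => ?_) i <;>
      simp [MeasurableEquiv.piFinSuccAbove, Fin.insertNthEquiv, mul_add]

lemma pl_euclidean (n : ℕ) : PL (EuclideanSpace ℝ (Fin n)) volume :=
  (pl_pi n).map _ (PiLp.volume_preserving_toLp (Fin n)) (fun _ _ => rfl)

lemma gauss_lint (n : ℕ) :
    ∫⁻ x : EuclideanSpace ℝ (Fin n), ENNReal.ofReal (rexp (-(π / 2) * ‖x‖ ^ 2)) =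
      ENNReal.ofReal ((2 : ℝ) ^ ((n : ℝ) / 2)) := by
  have h := GaussianFourier.integral_rexp_neg_mul_sq_norm (V := EuclideanSpace ℝ (Fin n))
    (b := π / 2) (by positivity)
  have e : π / (π / 2) = 2 := by field_simp
  rw [e] at h
  simp only [finrank_euclideanSpace, Fintype.card_fin] at h
  rw [← h, ofReal_integral_eq_lintegral_ofReal]
  · apply Integrable.of_integral_ne_zero
    rw [h]; positivity
  · exact Filter.Eventually.of_forall fun x => by positivity

lemma vol_two {n : ℕ} (K : Set (EuclideanSpace ℝ (Fin n))) :
    volume ((2 : ℝ) • K) = ENNReal.ofReal ((2 : ℝ) ^ n) * volume K := by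
  rw [Measure.addHaar_smul_of_nonneg _ (by norm_num)]
  simp

lemma const_eight (n : ℕ) : (8 : ℝ) ^ ((n : ℝ) / 2) = 2 ^ n * 2 ^ ((n : ℝ) / 2) := by
  have : (8 : ℝ) = 4 * 2 := by norm_num
  rw [this, Real.mul_rpow (by norm_num) (by norm_num)]
  congr 1
  have : (4 : ℝ) = 2 ^ (2 : ℝ) := by norm_num
  rw [this, ← Real.rpow_mul (by norm_num), ← Real.rpow_natCast]
  congr 1
  ring

lemma lower_lint {n : ℕ} (K : Set (EuclideanSpace ℝ (Fin n))) (hK : IsCompact K) :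
    ENNReal.ofReal ((8 : ℝ) ^ ((n : ℝ) / 2)) * volume K ≤
      (∫⁻ x, ENNReal.ofReal (rexp (-π * (Metric.infDist x K) ^ 2))) ^ 2 := by
  have hm : MeasurableSet ((2 : ℝ) • K) := (hK.smul (2 : ℝ)).measurableSet
  have := pl_euclidean n (((2 : ℝ) • K).indicator 1)
    (fun x => ENNReal.ofReal (rexp (-(π / 2) * ‖x‖ ^ 2)))
    (fun x => ENNReal.ofReal (rexp (-π * (Metric.infDist x K) ^ 2)))
    (measurable_one.indicator hm) (by fun_prop)
    (by
      have : Measurable fun x => Metric.infDist x K := measurable_infDist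
      fun_prop) (by
      intro x y
      by_cases hx : x ∈ (2 : ℝ) • K
      · obtain ⟨k, hk, rfl⟩ := hx
        have h1 : Metric.infDist ((1 / 2 : ℝ) • ((2 : ℝ) • k + y)) K ≤ ‖y‖ / 2 := by
          refine (Metric.infDist_le_dist_of_mem hk).trans (le_of_eq ?_)
          rw [dist_eq_norm, smul_add, smul_smul]
          norm_num [norm_smul]
          ring
        rw [Set.indicator_of_mem (Set.smul_mem_smul_set hk)]
        simp only [Pi.one_apply, one_mul]
        rw [← ENNReal.ofReal_pow (by positivity), ← Real.exp_nat_mul]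
        apply ENNReal.ofReal_le_ofReal
        apply Real.exp_le_exp.2
        have h2 := pow_le_pow_left₀ Metric.infDist_nonneg h1 2
        have := Real.pi_pos
        push_cast
        nlinarith
      · simp [hx])
  rw [gauss_lint, lintegral_indicator_one hm, vol_two] at this
  refine le_trans (le_of_eq ?_) this
  rw [const_eight, ENNReal.ofReal_mul (by positivity)]
  ring

lemma upper_lint {n : ℕ} (K : Set (EuclideanSpace ℝ (Fin n))) (hK : IsCompact K)
    (hc : Convex ℝ K) (hne : K.Nonempty) (y : EuclideanSpace ℝ (Fin n)) :
    (∫⁻ x, ENNReal.ofReal (rexp (-π * (Metric.infDist x K) ^ 2))) *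
      (∫⁻ z in K, ENNReal.ofReal (rexp (-π * ‖z + y‖ ^ 2))) ≤
    ENNReal.ofReal ((8 : ℝ) ^ ((n : ℝ) / 2)) * volume K := by
  have hm : MeasurableSet ((2 : ℝ) • K) := (hK.smul (2 : ℝ)).measurableSet
  have hm' : Measurable fun x => Metric.infDist x K := measurable_infDist
  rw [← lintegral_mul_const _ (by fun_prop)]
  calc _ ≤ ∫⁻ x, ∫⁻ z in (2 : ℝ) • K, ENNReal.ofReal (rexp (-(π / 2) * ‖x - y - z‖ ^ 2)) := by
        apply lintegral_mono
        intro x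
        dsimp only
        obtain ⟨p, hp, hp'⟩ := hK.exists_infDist_eq_dist hne x
        rw [← lintegral_const_mul _ (by fun_prop), ← lintegral_indicator hm,
          ← lintegral_indicator hK.measurableSet]
        rw [← lintegral_add_right_eq_self (((2 : ℝ) • K).indicator fun z =>
          ENNReal.ofReal (rexp (-(π / 2) * ‖x - y - z‖ ^ 2))) p]
        apply lintegral_mono
        intro z
        dsimp only
        by_cases hz : z ∈ K
        · have hzp : z + p ∈ (2 : ℝ) • K := by
            refine ⟨(1 / 2 : ℝ) • z + (1 / 2 : ℝ) • p,
              hc hz hp (by norm_num) (by norm_num) (by norm_num), ?_⟩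
            simp [smul_smul]
          rw [Set.indicator_of_mem hz, Set.indicator_of_mem hzp, ← ENNReal.ofReal_mul (by positivity),
            ← Real.exp_add]
          apply ENNReal.ofReal_le_ofReal
          apply Real.exp_le_exp.2
          rw [hp', dist_eq_norm]
          have e : x - y - (z + p) = (x - p) - (z + y) := by abel
          have h1 := parallelogram_law_with_norm ℝ (x - p) (z + y)
          rw [e]
          have := Real.pi_pos
          nlinarith [mul_nonneg this.le (sq_nonneg ‖x - p + (z + y)‖)]
        · simp [hz]
    _ = ∫⁻ z in (2 : ℝ) • K, ∫⁻ x, ENNReal.ofReal (rexp (-(π / 2) * ‖x - y - z‖ ^ 2)) := by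
        rw [lintegral_lintegral_swap]
        apply Measurable.aemeasurable
        fun_prop
    _ = _ := by
        have : ∀ z : EuclideanSpace ℝ (Fin n),
            ∫⁻ x, ENNReal.ofReal (rexp (-(π / 2) * ‖x - y - z‖ ^ 2)) =
            ENNReal.ofReal ((2 : ℝ) ^ ((n : ℝ) / 2)) := by
          intro z
          rw [← gauss_lint, ← lintegral_sub_right_eq_self (fun x : EuclideanSpace ℝ (Fin n) => ENNReal.ofReal (rexp (-(π / 2) * ‖x‖ ^ 2))) (y + z)]
          simp only [sub_sub]
        simp only [this]
        rw [setLIntegral_const, vol_two, const_eight, ENNReal.ofReal_mul (by positivity)]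
        ring

lemma gauss_change {n : ℕ} (K : Set (EuclideanSpace ℝ (Fin n)))
    (y : EuclideanSpace ℝ (Fin n)) :
    ∫ x in y +ᵥ Real.sqrt (2 * π) • K, (2 * π) ^ (-(n : ℝ) / 2) * Real.exp (-‖x‖ ^ 2 / 2) =
    ∫ z in K, rexp (-π * ‖z + (√(2 * π))⁻¹ • y‖ ^ 2) := by
  have sp : 0 < √(2 * π) := by positivity
  have s2 : √(2 * π) ^ 2 = 2 * π := Real.sq_sqrt (by positivity)
  have h1 : ∫ x in y +ᵥ Real.sqrt (2 * π) • K,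
      (2 * π) ^ (-(n : ℝ) / 2) * Real.exp (-‖x‖ ^ 2 / 2) =
      ∫ x in Real.sqrt (2 * π) • K, (2 * π) ^ (-(n : ℝ) / 2) * Real.exp (-‖y + x‖ ^ 2 / 2) := by
    have : y +ᵥ Real.sqrt (2 * π) • K = (fun x => y + x) '' (Real.sqrt (2 * π) • K) := rfl
    rw [this, (measurePreserving_add_left volume y).setIntegral_image_emb
      (measurableEmbedding_addLeft y)]
  have h2 := Measure.setIntegral_comp_smul_of_pos (volume : Measure (EuclideanSpace ℝ (Fin n)))
    (fun x => (2 * π) ^ (-(n : ℝ) / 2) * Real.exp (-‖y + x‖ ^ 2 / 2)) K sp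
  rw [h1]
  have h3 : ∀ z : EuclideanSpace ℝ (Fin n), -‖y + √(2 * π) • z‖ ^ 2 / 2 =
      -π * ‖z + (√(2 * π))⁻¹ • y‖ ^ 2 := by
    intro z
    have : y + √(2 * π) • z = √(2 * π) • (z + (√(2 * π))⁻¹ • y) := by
      rw [smul_add, smul_smul, mul_inv_cancel₀ sp.ne', one_smul, add_comm]
    rw [this, norm_smul, mul_pow, Real.norm_of_nonneg sp.le, s2]
    ring
  simp only [h3, integral_const_mul, finrank_euclideanSpace, Fintype.card_fin, smul_eq_mul] at h2 ⊢
  have h4 : (2 * π) ^ (-(n : ℝ) / 2) = (√(2 * π) ^ n)⁻¹ := by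
    rw [Real.sqrt_eq_rpow, ← Real.rpow_natCast, ← Real.rpow_mul (by positivity),
      ← Real.rpow_neg (by positivity)]
    congr 1
    ring
  have h5 : 0 < (√(2 * π) ^ n)⁻¹ := by positivity
  rw [h4] at h2 ⊢
  exact (mul_left_cancel₀ h5.ne' h2).symm

/-- For a convex body `K ⊆ ℝⁿ` with nonempty interior,
`(8^{n/2} vol(K))^{1/2} ≤ W(K) ≤ 8^{n/2} vol(K) / sup_y γₙ(y + √(2π)K)`. -/
theorem wills_volume_bounds {n : ℕ} (K : Set (EuclideanSpace ℝ (Fin n)))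
    (hK₁ : IsCompact K) (hK₂ : Convex ℝ K) (hK₃ : (interior K).Nonempty) :
    Real.sqrt ((8 : ℝ) ^ ((n : ℝ) / 2) * (volume K).toReal) ≤ wills K ∧
      wills K ≤ (8 : ℝ) ^ ((n : ℝ) / 2) * (volume K).toReal /
        ⨆ y : EuclideanSpace ℝ (Fin n),
          ∫ x in y +ᵥ Real.sqrt (2 * π) • K,
            (2 * π) ^ (-(n : ℝ) / 2) * Real.exp (-‖x‖ ^ 2 / 2) := by
  have hne : K.Nonempty := hK₃.mono interior_subset
  have hv0 : volume K ≠ 0 := (Measure.measure_pos_of_nonempty_interior _ hK₃).ne'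
  have hvt : volume K ≠ ⊤ := hK₁.measure_lt_top.ne
  have hvp : 0 < (volume K).toReal := ENNReal.toReal_pos hv0 hvt
  have hm' : Measurable fun x => Metric.infDist x K := measurable_infDist
  set A : ℝ := (8 : ℝ) ^ ((n : ℝ) / 2) * (volume K).toReal with hA
  have hAp : 0 < A := by positivity
  have hAe : ENNReal.ofReal ((8 : ℝ) ^ ((n : ℝ) / 2)) * volume K = ENNReal.ofReal A := by
    rw [hA, ENNReal.ofReal_mul (by positivity), ENNReal.ofReal_toReal hvt]
  set W : ENNReal := ∫⁻ x, ENNReal.ofReal (rexp (-π * (Metric.infDist x K) ^ 2)) with hW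
  have hwW : wills K = W.toReal := by
    rw [wills, hW, integral_eq_lintegral_of_nonneg_ae]
    · exact Filter.Eventually.of_forall fun x => by positivity
    · exact Measurable.aestronglyMeasurable (by fun_prop)
  have hI : ∀ y : EuclideanSpace ℝ (Fin n), IntegrableOn (fun z => rexp (-π * ‖z + y‖ ^ 2)) K :=
    fun y => ContinuousOn.integrableOn_compact hK₁ (by fun_prop)
  have hG : ∀ y : EuclideanSpace ℝ (Fin n),
      ∫⁻ z in K, ENNReal.ofReal (rexp (-π * ‖z + y‖ ^ 2)) =
        ENNReal.ofReal (∫ z in K, rexp (-π * ‖z + y‖ ^ 2)) := fun y =>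
    (ofReal_integral_eq_lintegral_ofReal (hI y)
      (Filter.Eventually.of_forall fun x => by positivity)).symm
  have hGp : ∀ y : EuclideanSpace ℝ (Fin n), 0 < ∫ z in K, rexp (-π * ‖z + y‖ ^ 2) := by
    intro y
    rw [setIntegral_pos_iff_support_of_nonneg_ae
      (Filter.Eventually.of_forall fun x => by positivity) (hI y)]
    have : Function.support (fun z => rexp (-π * ‖z + y‖ ^ 2)) = Set.univ := by
      ext z; simp [Real.exp_ne_zero]
    rw [this, Set.univ_inter]
    exact hv0.bot_lt
  have hU := fun y => upper_lint K hK₁ hK₂ hne y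
  have hL := lower_lint K hK₁
  simp only [hG, hAe, ← hW] at hU hL
  have hWt : W ≠ ⊤ := by
    intro h
    have := hU 0
    rw [h, ENNReal.top_mul (by simpa using hGp 0)] at this
    simp at this
  have hU' : ∀ y : EuclideanSpace ℝ (Fin n),
      W.toReal * (∫ z in K, rexp (-π * ‖z + y‖ ^ 2)) ≤ A := by
    intro y
    have := ENNReal.toReal_mono (by simp) (hU y)
    rwa [ENNReal.toReal_mul, ENNReal.toReal_ofReal (hGp y).le, ENNReal.toReal_ofReal hAp.le] at this
  have hL' : A ≤ W.toReal ^ 2 := by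
    have := ENNReal.toReal_mono (by simp [hWt]) hL
    rwa [ENNReal.toReal_pow, ENNReal.toReal_ofReal hAp.le] at this
  have hlow : √A ≤ W.toReal := by
    rw [Real.sqrt_le_iff]
    exact ⟨ENNReal.toReal_nonneg, hL'⟩
  have hWp : 0 < W.toReal := lt_of_lt_of_le (Real.sqrt_pos.2 hAp) hlow
  rw [hwW]
  refine ⟨hlow, ?_⟩
  simp only [gauss_change]
  have hb : ∀ y : EuclideanSpace ℝ (Fin n),
      ∫ z in K, rexp (-π * ‖z + (√(2 * π))⁻¹ • y‖ ^ 2) ≤ A / W.toReal := by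
    intro y
    rw [le_div_iff₀ hWp, mul_comm]
    exact hU' _
  have hS : (⨆ y : EuclideanSpace ℝ (Fin n),
      ∫ z in K, rexp (-π * ‖z + (√(2 * π))⁻¹ • y‖ ^ 2)) ≤ A / W.toReal := ciSup_le hb
  have hSp : 0 < ⨆ y : EuclideanSpace ℝ (Fin n),
      ∫ z in K, rexp (-π * ‖z + (√(2 * π))⁻¹ • y‖ ^ 2) := by
    refine lt_of_lt_of_le (hGp ((√(2 * π))⁻¹ • 0)) (le_ciSup (f := fun y : EuclideanSpace ℝ (Fin n) =>
      ∫ z in K, rexp (-π * ‖z + (√(2 * π))⁻¹ • y‖ ^ 2)) ⟨A / W.toReal, ?_⟩ 0)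
    rintro _ ⟨y, rfl⟩
    exact hb y
  rw [le_div_iff₀ hSp, mul_comm]
  exact (le_div_iff₀ hWp).1 hS
end

section
/- Let K ⊆ ℝⁿ be a 0-symmetric convex body (K = −K) which is in John position, i.e., B₂ⁿ ⊆ K and every ellipsoid (affine image of the Euclidean unit ball B₂ⁿ) contained in K has Lebesgue volume at most vol(B₂ⁿ). Then W(K) ≤ W([−1,1]ⁿ). -/
open scoped Pointwise
open MeasureTheory Metric Real

open Filter Topology in
lemma cdf_facts (f : ℝ → ℝ) (hc : Continuous f) (hpos : ∀ t, 0 < f t) (hi : Integrable f) :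
    ∃ P : ℝ → ℝ, (∀ t, HasDerivAt P (f t) t) ∧ StrictMono P ∧
      Tendsto P atBot (𝓝 0) ∧ Tendsto P atTop (𝓝 (∫ x, f x)) := by
  let P : ℝ → ℝ := fun t => ∫ x in Set.Iic t, f x
  have hP : ∀ a t, P t = P a + ∫ x in a..t, f x := fun a t => by
    have := intervalIntegral.integral_Iic_sub_Iic (a := a) (b := t) hi.integrableOn hi.integrableOn
    simp only [P]; linarith
  have hd : ∀ t, HasDerivAt P (f t) t := fun t => by
    have h1 : HasDerivAt (fun s => P 0 + ∫ x in (0:ℝ)..s, f x) (f t) t :=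
      (hc.integral_hasStrictDerivAt 0 t).hasDerivAt.const_add _
    exact h1.congr_of_eventuallyEq (Eventually.of_forall (fun s => hP 0 s))
  refine ⟨P, hd, strictMono_of_hasDerivAt_pos hd hpos, ?_, ?_⟩
  · have h1 := intervalIntegral_tendsto_integral_Iic (μ := volume) (f := f) 0 hi.integrableOn tendsto_id (l := atBot)
    have h2 : P = fun t => P 0 - ∫ x in t..0, f x := by
      ext t; have := hP t 0; linarith
    rw [h2]
    have := h1.const_sub (P 0)
    simpa [P] using this
  · exact (aecover_Iic tendsto_id).integral_tendsto_of_countably_generated hi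

open Filter Topology in
lemma StrictMono.between {P : ℝ → ℝ} {a b : ℝ} (h : StrictMono P)
    (h0 : Tendsto P atBot (𝓝 a)) (h1 : Tendsto P atTop (𝓝 b)) (t : ℝ) : a < P t ∧ P t < b := by
  constructor
  · exact (h.monotone.le_of_tendsto h0 (t - 1)).trans_lt (h (by linarith))
  · exact (h (show t < t + 1 by linarith)).trans_le (h.monotone.ge_of_tendsto h1 (t + 1))

open Filter Topology in
lemma exists_of_tendsto {P : ℝ → ℝ} {a b c : ℝ} (h : Continuous P)
    (h0 : Tendsto P atBot (𝓝 a)) (h1 : Tendsto P atTop (𝓝 b)) (ha : a < c) (hb : c < b) :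
    ∃ t, P t = c := by
  apply mem_range_of_exists_le_of_exists_ge h
  · obtain ⟨t, ht⟩ := (h0.eventually (gt_mem_nhds ha)).exists
    exact ⟨t, ht.le⟩
  · obtain ⟨t, ht⟩ := (h1.eventually (lt_mem_nhds hb)).exists
    exact ⟨t, ht.le⟩

open Filter Topology in
lemma transport (f g : ℝ → ℝ) (hf : Continuous f) (hfpos : ∀ t, 0 < f t) (hfi : Integrable f)
    (hg : Continuous g) (hgpos : ∀ t, 0 < g t) (hgi : Integrable g) (hfg : ∫ x, f x = ∫ x, g x) :
    ∃ T T' : ℝ → ℝ, (∀ t, HasDerivAt T (T' t) t) ∧ (∀ t, 0 < T' t) ∧ StrictMono T ∧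
      ∀ t, f t = T' t * g (T t) := by
  obtain ⟨P, P1, P2, P3, P4⟩ := cdf_facts f hf hfpos hfi
  obtain ⟨Q, Q1, Q2, Q3, Q4⟩ := cdf_facts g hg hgpos hgi
  rw [← hfg] at Q4
  have hPc : Continuous P := continuous_iff_continuousAt.2 fun t => (P1 t).continuousAt
  have hQc : Continuous Q := continuous_iff_continuousAt.2 fun t => (Q1 t).continuousAt
  have hT : ∀ t, ∃ s, Q s = P t := fun t =>
    exists_of_tendsto hQc Q3 Q4 (P2.between P3 P4 t).1 (P2.between P3 P4 t).2
  choose T hT using hT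
  have hmono : StrictMono T := fun a b hab => by
    rw [← Q2.lt_iff_lt, hT, hT]; exact P2 hab
  have hsurj : Function.Surjective T := fun s => by
    obtain ⟨t, ht⟩ := exists_of_tendsto hPc P3 P4 (Q2.between Q3 Q4 s).1 (Q2.between Q3 Q4 s).2
    exact ⟨t, Q2.injective (by rw [hT, ht])⟩
  have hTc : Continuous T := hmono.monotone.continuous_of_surjective hsurj
  refine ⟨T, fun t => (g (T t))⁻¹ * f t, fun t => ?_, fun t => ?_, hmono, fun t => ?_⟩
  · have hs : HasStrictDerivAt Q (g (T t)) (T t) :=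
      hasStrictDerivAt_of_hasDerivAt_of_continuousAt (Eventually.of_forall Q1) hg.continuousAt
    have hne := (hgpos (T t)).ne'
    have h1 := (hs.to_localInverse hne).hasDerivAt
    rw [hT] at h1
    have h2 := h1.comp t (P1 t)
    refine h2.congr_of_eventuallyEq ?_
    have h3 := hTc.continuousAt.eventually (hs.eventually_left_inverse hne)
    filter_upwards [h3] with s hs
    rw [hT] at hs
    exact hs.symm
  · have := hfpos t
    have := hgpos (T t)
    positivity
  · have := (hgpos (T t)).ne'
    field_simp

lemma isCompact_convexHull_of_isCompact {V : Type*} [NormedAddCommGroup V] [NormedSpace ℝ V]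
    [FiniteDimensional ℝ V] {S : Set V} (hS : IsCompact S) : IsCompact (convexHull ℝ S) := by
  rcases S.eq_empty_or_nonempty with rfl | ⟨p, hp⟩
  · simp
  let d := Module.finrank ℝ V + 1
  have hcomp : IsCompact ((stdSimplex ℝ (Fin d)) ×ˢ (Set.univ.pi fun _ : Fin d => S)) :=
    (isCompact_stdSimplex ℝ (Fin d)).prod (isCompact_univ_pi fun _ => hS)
  have himg := hcomp.image (f := fun q : (Fin d → ℝ) × (Fin d → V) => ∑ i, q.1 i • q.2 i)
    (by fun_prop)
  convert himg using 1
  apply Set.Subset.antisymm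
  · intro x hx
    obtain ⟨ι, _, z, w, hz, hind, hw, hw1, hx⟩ := eq_pos_convex_span_of_mem_convexHull hx
    have hcard : Fintype.card ι ≤ Fintype.card (Fin d) := by
      rw [Fintype.card_fin]
      exact hind.card_le_finrank_succ.trans (by simpa [d] using Submodule.finrank_le _)
    obtain ⟨e⟩ := Function.Embedding.nonempty_of_card_le hcard
    refine ⟨(Function.extend e w 0, Function.extend e z (fun _ => p)), ⟨⟨?_, ?_⟩, ?_⟩, ?_⟩
    · intro j
      by_cases hj : ∃ i, e i = j
      · obtain ⟨i, rfl⟩ := hj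
        simp only [e.injective.extend_apply]
        exact (hw i).le
      · simp [Function.extend_apply' _ _ _ hj]
    · rw [← hw1]
      refine (Fintype.sum_of_injective e e.injective _ _ (fun j hj => ?_) (fun i => ?_)).symm
      · exact Function.extend_apply' _ _ _ hj
      · exact (e.injective.extend_apply _ _ _).symm
    · intro j _
      by_cases hj : ∃ i, e i = j
      · obtain ⟨i, rfl⟩ := hj
        simp only [e.injective.extend_apply]
        exact hz ⟨i, rfl⟩
      · simpa [Function.extend_apply' _ _ _ hj] using hp
    · rw [← hx]
      refine (Fintype.sum_of_injective e e.injective _ _ (fun j hj => ?_) (fun i => ?_)).symm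
      · have : ¬ ∃ i, e i = j := hj
        simp [Function.extend_apply' _ _ _ this]
      · simp [e.injective.extend_apply]
  · rintro _ ⟨⟨w, z⟩, ⟨⟨h0, h1⟩, h2⟩, rfl⟩
    exact (convex_convexHull ℝ S).sum_mem (fun i _ => h0 i) h1
      (fun i _ => subset_convexHull ℝ S (h2 i trivial))

section dec
variable {E : Type*} [NormedAddCommGroup E] [InnerProductSpace ℝ E] [FiniteDimensional ℝ E]
  {ι : Type*} [Fintype ι]

lemma dec_norm_sq (c : ι → ℝ) (u : ι → E) (h : ∀ x, ∑ i, (c i * inner ℝ (u i) x) • u i = x) (x : E) :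
    ∑ i, c i * inner ℝ (u i) x ^ 2 = ‖x‖ ^ 2 := by
  conv_rhs => rw [← real_inner_self_eq_norm_sq]; enter [2]; rw [← h x]
  rw [sum_inner]
  refine Finset.sum_congr rfl fun i _ => ?_
  rw [real_inner_smul_left]; ring

lemma dec_sum (c : ι → ℝ) (u : ι → E) (hu : ∀ i, ‖u i‖ = 1)
    (h : ∀ x, ∑ i, (c i * inner ℝ (u i) x) • u i = x) :
    ∑ i, c i = Module.finrank ℝ E := by
  let b := stdOrthonormalBasis ℝ E
  have h1 : ∀ i, c i = ∑ k, c i * inner ℝ (u i) (b k) ^ 2 := fun i => by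
    have := b.sum_sq_norm_inner_left (u i)
    simp only [Real.norm_eq_abs, sq_abs, hu] at this
    rw [← Finset.mul_sum, this]; simp
  rw [Finset.sum_congr rfl fun i _ => h1 i, Finset.sum_comm]
  simp [dec_norm_sq c u h]

lemma ball_det (c : ι → ℝ) (u : ι → E) (hc : ∀ i, 0 ≤ c i) (hu : ∀ i, ‖u i‖ = 1)
    (h : ∀ x, ∑ i, (c i * inner ℝ (u i) x) • u i = x) (t : ι → ℝ) (ht : ∀ i, 0 < t i)
    (A : E →ₗ[ℝ] E) (hA : ∀ x, A x = ∑ i, (c i * t i * inner ℝ (u i) x) • u i) :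
    ∏ i, t i ^ c i ≤ LinearMap.det A := by
  have hinner : ∀ x y, inner ℝ (A x) y = ∑ i, c i * t i * inner ℝ (u i) x * inner ℝ (u i) y := by
    intro x y
    rw [hA, sum_inner]
    exact Finset.sum_congr rfl fun i _ => by rw [real_inner_smul_left]
  have hsym : A.IsSymmetric := fun x y => by
    rw [real_inner_comm _ x, hinner, hinner]
    exact Finset.sum_congr rfl fun i _ => by ring
  rw [hsym.det_eq_prod_eigenvalues rfl]
  let b := hsym.eigenvectorBasis rfl
  have hev : ∀ k, hsym.eigenvalues rfl k = ∑ i, (c i * inner ℝ (u i) (b k) ^ 2) * t i := by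
    intro k
    have h1 := hinner (b k) (b k)
    rw [hsym.apply_eigenvectorBasis, real_inner_smul_left, real_inner_self_eq_norm_sq] at h1
    simp only [OrthonormalBasis.norm_eq_one, b] at h1
    simp only [RCLike.ofReal_real_eq_id, id, one_pow, mul_one] at h1
    rw [h1]
    exact Finset.sum_congr rfl fun i _ => by ring
  have hle : ∀ k, ∏ i, t i ^ (c i * inner ℝ (u i) (b k) ^ 2) ≤ hsym.eigenvalues rfl k := by
    intro k
    rw [hev]
    refine Real.geom_mean_le_arith_mean_weighted _ _ _ (fun i _ => ?_) ?_ (fun i _ => (ht i).le)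
    · have := hc i; positivity
    · rw [dec_norm_sq c u h]; simp
  calc ∏ i, t i ^ c i = ∏ k, ∏ i, t i ^ (c i * inner ℝ (u i) (b k) ^ 2) := by
        rw [Finset.prod_comm]
        refine Finset.prod_congr rfl fun i _ => ?_
        rw [← Real.rpow_sum_of_pos (ht i), ← Finset.mul_sum]
        have := b.sum_sq_norm_inner_left (u i)
        simp only [Real.norm_eq_abs, sq_abs, hu] at this
        rw [this]; simp
    _ ≤ _ := by
        refine Finset.prod_le_prod (fun k _ => Finset.prod_nonneg fun i _ => ?_) (fun k _ => hle k)
        exact (Real.rpow_pos_of_pos (ht i) _).le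

end dec

section BL
variable {E : Type*} [NormedAddCommGroup E] [InnerProductSpace ℝ E] [FiniteDimensional ℝ E]
  [MeasurableSpace E] [BorelSpace E] {ι : Type*} [Fintype ι]

lemma brascamp_lieb (c : ι → ℝ) (u : ι → E) (hc : ∀ i, 0 ≤ c i) (hu : ∀ i, ‖u i‖ = 1)
    (h : ∀ x, ∑ i, (c i * inner ℝ (u i) x) • u i = x)
    (f : ℝ → ℝ) (hf : Continuous f) (hfpos : ∀ t, 0 < f t) (hfi : Integrable f) :
    ∫⁻ x : E, ENNReal.ofReal (∏ i, f (inner ℝ (u i) x) ^ c i) ≤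
      ENNReal.ofReal ((∫ t, f t) ^ Module.finrank ℝ E) := by
  set F := ∫ t, f t with hF
  have hFpos : 0 < F := by
    rw [hF, integral_pos_iff_support_of_nonneg (fun t => (hfpos t).le) hfi]
    have : Function.support f = Set.univ := Set.eq_univ_of_forall fun t => (hfpos t).ne'
    simp [this]
  have hgi : Integrable (fun t : ℝ => rexp (-π * t ^ 2)) := integrable_exp_neg_mul_sq pi_pos
  have hgint : ∫ t : ℝ, rexp (-π * t ^ 2) = 1 := by
    rw [integral_gaussian, div_self pi_pos.ne', Real.sqrt_one]
  obtain ⟨T, T', hT, hT'pos, hTm, hfT⟩ := transport f (fun t => F * rexp (-π * t ^ 2)) hf hfpos hfi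
    (by fun_prop) (fun t => by positivity) (hgi.const_mul F)
    (by rw [integral_const_mul, hgint, mul_one])
  let Θ : E → E := fun x => ∑ i, (c i * T (inner ℝ (u i) x)) • u i
  let D : E → E →L[ℝ] E := fun x =>
    ∑ i, ((c i * T' (inner ℝ (u i) x)) • innerSL ℝ (u i)).smulRight (u i)
  have hD : ∀ x, HasFDerivAt Θ (D x) x := fun x => by
    refine HasFDerivAt.fun_sum fun i _ => ?_
    refine HasFDerivAt.smul_const ?_ (u i)
    have h1 : HasFDerivAt (fun x => inner ℝ (u i) x) (innerSL ℝ (u i)) x :=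
      (innerSL ℝ (u i)).hasFDerivAt
    have h2 := ((hT (inner ℝ (u i) x)).comp_hasFDerivAt x h1).const_mul (c i)
    rw [smul_smul] at h2
    exact h2
  have hinj : Function.Injective Θ := by
    intro x y hxy
    have h0 : inner ℝ (Θ x - Θ y) (x - y) = 0 := by rw [hxy, sub_self, inner_zero_left]
    have h1 : ∑ i, c i * ((T (inner ℝ (u i) x) - T (inner ℝ (u i) y)) *
        (inner ℝ (u i) x - inner ℝ (u i) y)) = 0 := by
      rw [← h0]
      simp only [Θ]
      rw [← Finset.sum_sub_distrib, sum_inner]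
      refine Finset.sum_congr rfl fun i _ => ?_
      rw [← sub_smul, real_inner_smul_left, inner_sub_right]; ring
    rw [Finset.sum_eq_zero_iff_of_nonneg] at h1
    · have h2 := h (x - y)
      rw [Finset.sum_eq_zero] at h2
      · exact (sub_eq_zero.1 h2.symm)
      · intro i hi
        have h3 := h1 i hi
        rcases mul_eq_zero.1 h3 with h4 | h4
        · simp [h4]
        · have : inner ℝ (u i) x - inner ℝ (u i) y = 0 := by
            rcases mul_eq_zero.1 h4 with h5 | h5
            · rw [sub_eq_zero] at h5 ⊢
              exact hTm.injective h5
            · exact h5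
          rw [inner_sub_right, this]; simp
    · intro i _
      refine mul_nonneg (hc i) ?_
      rcases le_total (inner ℝ (u i) x) (inner ℝ (u i) y) with h5 | h5
      · exact mul_nonneg_of_nonpos_of_nonpos (sub_nonpos.2 (hTm.monotone h5)) (sub_nonpos.2 h5)
      · exact mul_nonneg (sub_nonneg.2 (hTm.monotone h5)) (sub_nonneg.2 h5)
  have hΘn : ∀ x, ‖Θ x‖ ^ 2 ≤ ∑ i, c i * T (inner ℝ (u i) x) ^ 2 := by
    intro x
    have h1 : ∑ i, c i * T (inner ℝ (u i) x) * inner ℝ (u i) (Θ x) = ‖Θ x‖ ^ 2 := by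
      rw [← real_inner_self_eq_norm_sq]
      have h5 : inner ℝ (Θ x) (Θ x) =
        inner ℝ (∑ i, (c i * T (inner ℝ (u i) x)) • u i) (Θ x) := rfl
      rw [h5, sum_inner]
      exact Finset.sum_congr rfl fun i _ => by rw [real_inner_smul_left]
    have h2 := dec_norm_sq c u h (Θ x)
    have h3 : 0 ≤ ∑ i, c i * (T (inner ℝ (u i) x) - inner ℝ (u i) (Θ x)) ^ 2 :=
      Finset.sum_nonneg fun i _ => mul_nonneg (hc i) (sq_nonneg _)
    have h4 : ∑ i, c i * (T (inner ℝ (u i) x) - inner ℝ (u i) (Θ x)) ^ 2 =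
        ∑ i, c i * T (inner ℝ (u i) x) ^ 2
          - 2 * ∑ i, c i * T (inner ℝ (u i) x) * inner ℝ (u i) (Θ x)
          + ∑ i, c i * inner ℝ (u i) (Θ x) ^ 2 := by
      rw [Finset.mul_sum, ← Finset.sum_sub_distrib, ← Finset.sum_add_distrib]
      exact Finset.sum_congr rfl fun i _ => by ring
    rw [h4, h1, h2] at h3
    linarith
  have hdet : ∀ x, ∏ i, T' (inner ℝ (u i) x) ^ c i ≤ (D x).det := fun x => by
    refine ball_det c u hc hu h (fun i => T' (inner ℝ (u i) x)) (fun i => hT'pos _) _ (fun y => ?_)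
    simp [D]
  have hprodpos : ∀ x, 0 ≤ ∏ i, T' (inner ℝ (u i) x) ^ c i := fun x =>
    Finset.prod_nonneg fun i _ => (Real.rpow_pos_of_pos (hT'pos _) _).le
  have hpt : ∀ x, ∏ i, f (inner ℝ (u i) x) ^ c i ≤
      F ^ Module.finrank ℝ E * (|(D x).det| * rexp (-π * ‖Θ x‖ ^ 2)) := by
    intro x
    have h1 : ∏ i, f (inner ℝ (u i) x) ^ c i = F ^ Module.finrank ℝ E *
        ((∏ i, T' (inner ℝ (u i) x) ^ c i) *
          rexp (-π * ∑ i, c i * T (inner ℝ (u i) x) ^ 2)) := by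
      have h2 : F ^ Module.finrank ℝ E = ∏ i, F ^ c i := by
        rw [← Real.rpow_sum_of_pos hFpos, dec_sum c u hu h, Real.rpow_natCast]
      rw [h2, Finset.mul_sum, Real.exp_sum, ← Finset.prod_mul_distrib, ← Finset.prod_mul_distrib]
      refine Finset.prod_congr rfl fun i _ => ?_
      have := (hT'pos (inner ℝ (u i) x)).le
      rw [hfT, Real.mul_rpow this (by positivity), Real.mul_rpow hFpos.le (by positivity),
        ← Real.exp_mul]
      have e : -π * T (inner ℝ (u i) x) ^ 2 * c i = -π * (c i * T (inner ℝ (u i) x) ^ 2) := by ring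
      rw [e]; ring
    rw [h1]
    have h3 : rexp (-π * ∑ i, c i * T (inner ℝ (u i) x) ^ 2) ≤ rexp (-π * ‖Θ x‖ ^ 2) := by
      apply Real.exp_le_exp.2
      have := mul_le_mul_of_nonneg_left (hΘn x) pi_pos.le
      linarith
    have h4 := (hdet x).trans (le_abs_self _)
    have := hprodpos x
    gcongr
  have hcv := lintegral_image_eq_lintegral_abs_det_fderiv_mul (volume : Measure E)
    MeasurableSet.univ (fun x _ => (hD x).hasFDerivWithinAt) hinj.injOn
    (fun x => ENNReal.ofReal (rexp (-π * ‖x‖ ^ 2)))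
  have hgE : ∫⁻ x : E, ENNReal.ofReal (rexp (-π * ‖x‖ ^ 2)) = 1 := by
    have h1 := GaussianFourier.integral_rexp_neg_mul_sq_norm (V := E) pi_pos
    rw [div_self pi_pos.ne', Real.one_rpow] at h1
    rw [← ofReal_integral_eq_lintegral_ofReal, h1, ENNReal.ofReal_one]
    · by_contra hni
      rw [integral_undef hni] at h1
      norm_num at h1
    · exact Filter.Eventually.of_forall fun x => (Real.exp_pos _).le
  calc ∫⁻ x : E, ENNReal.ofReal (∏ i, f (inner ℝ (u i) x) ^ c i)
      ≤ ∫⁻ x : E, ENNReal.ofReal (F ^ Module.finrank ℝ E) *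
          (ENNReal.ofReal |(D x).det| * ENNReal.ofReal (rexp (-π * ‖Θ x‖ ^ 2))) := by
        refine lintegral_mono fun x => ?_
        rw [← ENNReal.ofReal_mul (abs_nonneg _), ← ENNReal.ofReal_mul (by positivity)]
        exact ENNReal.ofReal_le_ofReal (hpt x)
    _ = ENNReal.ofReal (F ^ Module.finrank ℝ E) * ∫⁻ x : E,
          (ENNReal.ofReal |(D x).det| * ENNReal.ofReal (rexp (-π * ‖Θ x‖ ^ 2))) :=
        lintegral_const_mul' _ _ ENNReal.ofReal_ne_top
    _ ≤ ENNReal.ofReal (F ^ Module.finrank ℝ E) * 1 := by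
        gcongr
        rw [Measure.restrict_univ] at hcv
        rw [← hcv, ← hgE]
        exact setLIntegral_le_lintegral _ _
    _ = _ := mul_one _

end BL

section John
variable {n : ℕ}

lemma not_subset_imp {E : Type*} [NormedAddCommGroup E] [InnerProductSpace ℝ E] [FiniteDimensional ℝ E]
    {K : Set E} (hK₁ : IsCompact K) (hK₂ : Convex ℝ K) (hK₃ : K.Nonempty)
    (A : E →L[ℝ] E) (hA : ¬ A '' closedBall 0 1 ⊆ K) :
    ∃ y : E, ‖y‖ = 1 ∧ ∀ k ∈ K, inner ℝ y k < ‖A.adjoint y‖ := by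
  rw [Set.not_subset] at hA
  obtain ⟨_, ⟨x, hx, rfl⟩, hxK⟩ := hA
  obtain ⟨f, s, hf, hs⟩ := geometric_hahn_banach_closed_point hK₂ hK₁.isClosed hxK
  obtain ⟨k0, hk0⟩ := hK₃
  let y := (InnerProductSpace.toDual ℝ E).symm f
  have hy : ∀ z, inner ℝ y z = f z := fun z => InnerProductSpace.toDual_symm_apply
  have hy0 : y ≠ 0 := by
    intro h0
    have h1 := hf k0 hk0
    have h2 := hs
    rw [← hy, h0, inner_zero_left] at h1 h2
    linarith
  have hyn : 0 < ‖y‖ := norm_pos_iff.2 hy0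
  refine ⟨‖y‖⁻¹ • y, by rw [norm_smul, norm_inv, norm_norm, inv_mul_cancel₀ hyn.ne'], fun k hk => ?_⟩
  rw [map_smul, norm_smul, norm_inv, norm_norm, real_inner_smul_left]
  refine mul_lt_mul_of_pos_left ?_ (inv_pos.2 hyn)
  rw [hy]
  refine ((hf k hk).trans hs).trans_le ?_
  rw [← hy, ← ContinuousLinearMap.adjoint_inner_left]
  refine (real_inner_le_norm _ _).trans ?_
  have : ‖x‖ ≤ 1 := by simpa using hx
  exact mul_le_of_le_one_right (norm_nonneg _) this

open Filter Topology in
lemma john_variation (K : Set (EuclideanSpace ℝ (Fin n)))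
    (hK₁ : IsCompact K) (hK₂ : Convex ℝ K) (hK₃ : K.Nonempty)
    (hball : Metric.closedBall (0 : EuclideanSpace ℝ (Fin n)) 1 ⊆ K)
    (hJohn : ∀ f : EuclideanSpace ℝ (Fin n) →ᵃ[ℝ] EuclideanSpace ℝ (Fin n),
      f '' Metric.closedBall 0 1 ⊆ K →
        volume (f '' Metric.closedBall 0 1) ≤
          volume (Metric.closedBall (0 : EuclideanSpace ℝ (Fin n)) 1))
    (H : Matrix (Fin n) (Fin n) ℝ) (htr : 0 < H.trace) :
    ∃ y : EuclideanSpace ℝ (Fin n), ‖y‖ = 1 ∧ (∀ k ∈ K, inner ℝ y k ≤ 1) ∧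
      0 ≤ inner ℝ y (Matrix.toEuclideanLin H y) := by
  -- determinant
  have hdet : ∀ᶠ δ in 𝓝[>] (0 : ℝ), 1 < (1 + δ • H).det := by
    let p := (1 + (Polynomial.X : Polynomial ℝ) • H.map (⇑Polynomial.C)).det.divX.divX
    have h1 : Tendsto (fun δ : ℝ => H.trace + p.eval δ * δ) (𝓝[>] 0) (𝓝 (H.trace + p.eval 0 * 0)) := by
      apply Tendsto.mono_left _ nhdsWithin_le_nhds
      exact (Continuous.tendsto (by fun_prop) _)
    have h2 := h1.eventually (lt_mem_nhds (a := 0) (by simpa using htr))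
    filter_upwards [h2, self_mem_nhdsWithin] with δ hδ hpos
    rw [Matrix.det_one_add_smul]
    have h3 := mul_pos hδ hpos
    change 1 < 1 + H.trace * δ + p.eval δ * δ ^ 2
    nlinarith
  let L : (EuclideanSpace ℝ (Fin n)) →L[ℝ] (EuclideanSpace ℝ (Fin n)) := LinearMap.toContinuousLinearMap (Matrix.toEuclideanLin H)
  have hex : ∀ᶠ δ in 𝓝[>] (0 : ℝ), ∃ y : (EuclideanSpace ℝ (Fin n)), ‖y‖ = 1 ∧
      ∀ k ∈ K, inner ℝ y k < ‖y + δ • L.adjoint y‖ := by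
    filter_upwards [hdet] with δ hδ
    let A : (EuclideanSpace ℝ (Fin n)) →L[ℝ] (EuclideanSpace ℝ (Fin n)) := ContinuousLinearMap.id ℝ (EuclideanSpace ℝ (Fin n)) + δ • L
    have hAdet : LinearMap.det (A : (EuclideanSpace ℝ (Fin n)) →ₗ[ℝ] (EuclideanSpace ℝ (Fin n))) = (1 + δ • H).det := by
      have : (A : (EuclideanSpace ℝ (Fin n)) →ₗ[ℝ] (EuclideanSpace ℝ (Fin n))) = Matrix.toEuclideanLin (1 + δ • H) := by
        ext x i
        simp [A, L]
      rw [this, Matrix.toEuclideanLin_eq_toLin_orthonormal, LinearMap.det_toLin]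
    have hns : ¬ A '' closedBall 0 1 ⊆ K := by
      intro hsub
      have h1 := hJohn (A : (EuclideanSpace ℝ (Fin n)) →ₗ[ℝ] (EuclideanSpace ℝ (Fin n))).toAffineMap hsub
      have h2 : volume ((A : (EuclideanSpace ℝ (Fin n)) →ₗ[ℝ] (EuclideanSpace ℝ (Fin n))).toAffineMap '' closedBall 0 1)
        = ENNReal.ofReal |LinearMap.det (A : (EuclideanSpace ℝ (Fin n)) →ₗ[ℝ] (EuclideanSpace ℝ (Fin n)))| * volume (closedBall (0 : (EuclideanSpace ℝ (Fin n))) 1) :=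
        Measure.addHaar_image_linearMap volume (A : (EuclideanSpace ℝ (Fin n)) →ₗ[ℝ] (EuclideanSpace ℝ (Fin n))) (closedBall 0 1)
      rw [h2, hAdet] at h1
      have hb0 : volume (closedBall (0 : (EuclideanSpace ℝ (Fin n))) 1) ≠ 0 := (measure_closedBall_pos _ _ one_pos).ne'
      have hbt : volume (closedBall (0 : (EuclideanSpace ℝ (Fin n))) 1) ≠ ⊤ := measure_closedBall_lt_top.ne
      have h3 : (1 : ENNReal) < ENNReal.ofReal |(1 + δ • H).det| := by
        rw [← ENNReal.ofReal_one]
        exact (ENNReal.ofReal_lt_ofReal_iff_of_nonneg zero_le_one).2 (hδ.trans_le (le_abs_self _))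
      have h4 := ENNReal.mul_lt_mul_left hb0 hbt h3
      rw [one_mul] at h4
      exact absurd h1 (not_le.2 h4)
    obtain ⟨y, hy, hyk⟩ := not_subset_imp hK₁ hK₂ hK₃ A hns
    refine ⟨y, hy, ?_⟩
    have : A.adjoint y = y + δ • L.adjoint y := by
      have h5 : ContinuousLinearMap.adjoint (ContinuousLinearMap.id ℝ (EuclideanSpace ℝ (Fin n)))
          = ContinuousLinearMap.id ℝ _ := ContinuousLinearMap.adjoint_id
      simp [A, h5]
    rwa [this] at hyk
  obtain ⟨δ, hδ0, hδ⟩ : ∃ δ : ℕ → ℝ, Tendsto δ atTop (𝓝[>] 0) ∧ ∀ m, 0 < δ m ∧ ∃ y : (EuclideanSpace ℝ (Fin n)), ‖y‖ = 1 ∧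
      ∀ k ∈ K, inner ℝ y k < ‖y + δ m • L.adjoint y‖ := by
    obtain ⟨δ, hδ, hp⟩ := exists_seq_forall_of_frequently (hex.and self_mem_nhdsWithin).frequently
    exact ⟨δ, hδ, fun m => ⟨(hp m).2, (hp m).1⟩⟩
  choose hpos y hy1 hy2 using hδ
  have hδ0 := hδ0.mono_right nhdsWithin_le_nhds
  obtain ⟨y0, hy0, φ, hφ, hlim⟩ := (isCompact_sphere (0 : (EuclideanSpace ℝ (Fin n))) 1).tendsto_subseq
    (x := y) (fun m => by simpa using hy1 m)
  have hδφ : Tendsto (δ ∘ φ) atTop (𝓝 0) := hδ0.comp hφ.tendsto_atTop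
  have hLlim : Tendsto (fun m => L.adjoint (y (φ m))) atTop (𝓝 (L.adjoint y0)) :=
    (L.adjoint.continuous.tendsto _).comp hlim
  have hsum : Tendsto (fun m => ‖y (φ m) + δ (φ m) • L.adjoint (y (φ m))‖) atTop (𝓝 1) := by
    have h1 := (hlim.add (hδφ.smul hLlim)).norm
    have h2 : ‖y0‖ = 1 := by simpa using hy0
    simpa [h2] using h1
  refine ⟨y0, by simpa using hy0, fun k hk => ?_, ?_⟩
  · have h1 : Tendsto (fun m => inner ℝ (y (φ m)) k) atTop (𝓝 (inner ℝ y0 k)) :=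
      hlim.inner tendsto_const_nhds
    exact le_of_tendsto_of_tendsto' h1 hsum fun m => (hy2 (φ m) k hk).le
  · have h1 : Tendsto (fun m => 2 * inner ℝ (y (φ m)) (L (y (φ m))) +
        δ (φ m) * ‖L.adjoint (y (φ m))‖ ^ 2) atTop
        (𝓝 (2 * inner ℝ y0 (L y0) + 0 * ‖L.adjoint y0‖ ^ 2)) := by
      refine ((hlim.inner ((L.continuous.tendsto _).comp hlim)).const_mul 2).add
        (hδφ.mul (hLlim.norm.pow 2))
    have h2 : 0 ≤ 2 * inner ℝ y0 (L y0) + 0 * ‖L.adjoint y0‖ ^ 2 := by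
      refine ge_of_tendsto' h1 fun m => ?_
      have hk := hy2 (φ m) (y (φ m)) (hball (by simp [hy1 (φ m)]))
      rw [real_inner_self_eq_norm_sq, hy1] at hk
      have h3 : 1 < ‖y (φ m) + δ (φ m) • L.adjoint (y (φ m))‖ ^ 2 := by nlinarith
      rw [norm_add_sq_real, hy1, real_inner_smul_right, ContinuousLinearMap.adjoint_inner_right,
        norm_smul, Real.norm_eq_abs, abs_of_pos (hpos _), real_inner_comm] at h3
      have hp := hpos (φ m)
      by_contra hneg
      push Not at hneg
      have := mul_neg_of_pos_of_neg hp hneg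
      nlinarith
    have h3 : 0 ≤ inner ℝ y0 (L y0) := by linarith
    exact h3

lemma john_decomposition (K : Set (EuclideanSpace ℝ (Fin n)))
    (hK₁ : IsCompact K) (hK₂ : Convex ℝ K) (hK₃ : K.Nonempty)
    (hball : Metric.closedBall (0 : EuclideanSpace ℝ (Fin n)) 1 ⊆ K)
    (hJohn : ∀ f : EuclideanSpace ℝ (Fin n) →ᵃ[ℝ] EuclideanSpace ℝ (Fin n),
      f '' Metric.closedBall 0 1 ⊆ K →
        volume (f '' Metric.closedBall 0 1) ≤
          volume (Metric.closedBall (0 : EuclideanSpace ℝ (Fin n)) 1)) :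
    ∃ (ι : Type) (_ : Fintype ι) (c : ι → ℝ) (u : ι → EuclideanSpace ℝ (Fin n)),
      (∀ i, 0 ≤ c i) ∧ (∀ i, ‖u i‖ = 1) ∧ (∀ i, ∀ k ∈ K, inner ℝ (u i) k ≤ 1) ∧
      ∀ x, ∑ i, (c i * inner ℝ (u i) x) • u i = x := by
  rcases Nat.eq_zero_or_pos n with rfl | hn
  · exact ⟨Fin 0, inferInstance, Fin.elim0, Fin.elim0, fun i => i.elim0, fun i => i.elim0,
      fun i => i.elim0, fun x => Subsingleton.elim _ _⟩
  have hn' : (0 : ℝ) < n := by exact_mod_cast hn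
  let U : Set (EuclideanSpace ℝ (Fin n)) := {u | ‖u‖ = 1 ∧ ∀ k ∈ K, inner ℝ u k ≤ 1}
  have hU : IsCompact U := by
    refine (isCompact_sphere (0 : EuclideanSpace ℝ (Fin n)) 1).of_isClosed_subset ?_ ?_
    · have : U = {u | ‖u‖ = 1} ∩ ⋂ k ∈ K, {u | inner ℝ u k ≤ 1} := by
        ext u; simp [U]
      rw [this]
      refine IsClosed.inter (isClosed_eq continuous_norm continuous_const) ?_
      exact isClosed_biInter fun k _ => isClosed_le (by fun_prop) continuous_const
    · intro u hu
      simpa using hu.1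
  let φ : EuclideanSpace ℝ (Fin n) → (Fin n × Fin n → ℝ) := fun u p => u p.1 * u p.2
  have hφ : Continuous φ := by
    refine continuous_pi fun p => ?_
    exact Continuous.mul (by fun_prop) (by fun_prop)
  have hC := isCompact_convexHull_of_isCompact (hU.image hφ)
  let J : Fin n × Fin n → ℝ := fun p => if p.1 = p.2 then (n : ℝ)⁻¹ else 0
  have hJ : J ∈ convexHull ℝ (φ '' U) := by
    by_contra hJ
    obtain ⟨f, s, hf, hs⟩ := geometric_hahn_banach_closed_point (convex_convexHull ℝ _) hC.isClosed hJ
    let G : Matrix (Fin n) (Fin n) ℝ := fun i j => f (Pi.single (i, j) 1)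
    have hfG : ∀ M : Fin n × Fin n → ℝ, f M = ∑ i, ∑ j, M (i, j) * G i j := by
      intro M
      conv_lhs => rw [pi_eq_sum_univ' M]
      rw [map_sum, Fintype.sum_prod_type]
      refine Finset.sum_congr rfl fun i _ => Finset.sum_congr rfl fun j _ => ?_
      rw [map_smul, smul_eq_mul]
    have hfJ : f J = (n : ℝ)⁻¹ * G.trace := by
      rw [hfG]
      simp [J, Matrix.trace, Finset.mul_sum]
    obtain ⟨y, hy1, hy2, hy3⟩ := john_variation K hK₁ hK₂ hK₃ hball hJohn (G - s • 1) (by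
      rw [Matrix.trace_sub, Matrix.trace_smul, Matrix.trace_one, Fintype.card_fin, smul_eq_mul]
      rw [hfJ, inv_mul_eq_div, lt_div_iff₀ hn'] at hs
      linarith)
    have h1 := hf (φ y) (subset_convexHull ℝ _ ⟨y, ⟨hy1, hy2⟩, rfl⟩)
    have h2 : inner ℝ y (Matrix.toEuclideanLin (G - s • 1) y) = f (φ y) - s := by
      have h3 : Matrix.toEuclideanLin (G - s • 1) y = Matrix.toEuclideanLin G y - s • y := by
        ext i
        simp
      rw [h3, inner_sub_right, real_inner_smul_right, real_inner_self_eq_norm_sq, hy1, hfG]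
      simp only [PiLp.inner_apply, Matrix.toLpLin_apply, Matrix.mulVec, dotProduct, φ]
      simp only [RCLike.inner_apply, conj_trivial, Finset.sum_mul, one_pow, mul_one]
      congr 1
      refine Finset.sum_congr rfl fun i _ => Finset.sum_congr rfl fun j _ => ?_
      ring
    rw [h2] at hy3
    linarith
  rw [convexHull_eq] at hJ
  obtain ⟨ι, t, w, z, hw0, hw1, hz, hJ⟩ := hJ
  have hz' : ∀ i : t, ∃ u ∈ U, φ u = z i := fun i => hz i i.2
  choose u hu hφu using hz'
  rw [Finset.centerMass_eq_of_sum_1 _ _ hw1, ← Finset.sum_coe_sort] at hJ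
  refine ⟨t, inferInstance, fun i => n * w i, u, fun i => mul_nonneg hn'.le (hw0 i i.2),
    fun i => (hu i).1, fun i => (hu i).2, fun x => ?_⟩
  have hent : ∀ a b, ∑ i : t, n * w i * (u i a * u i b) = if a = b then 1 else 0 := by
    intro a b
    have h1 := congrFun hJ (a, b)
    simp only [Finset.sum_apply, Pi.smul_apply, ← hφu, φ, smul_eq_mul, J] at h1
    simp only [mul_assoc]
    rw [← Finset.mul_sum, h1]
    split_ifs
    · exact mul_inv_cancel₀ hn'.ne'
    · simp
  ext a
  calc (∑ i : t, (n * w i * inner ℝ (u i) x) • u i) a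
      = ∑ i : t, n * w i * (∑ b, x b * u i b) * u i a := by
        simp [PiLp.inner_apply]
    _ = ∑ b, x b * ∑ i : t, n * w i * (u i a * u i b) := by
        simp only [Finset.mul_sum, Finset.sum_mul]
        rw [Finset.sum_comm]
        exact Finset.sum_congr rfl fun i _ => Finset.sum_congr rfl fun j _ => by ring
    _ = x a := by simp only [hent]; simp

end John

/-- The one-dimensional density. -/
noncomputable def f0 (t : ℝ) : ℝ := rexp (-π * (max (|t| - 1) 0) ^ 2)

lemma f0_continuous : Continuous f0 := by unfold f0; fun_prop

lemma f0_pos (t : ℝ) : 0 < f0 t := Real.exp_pos _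

lemma f0_integrable : Integrable f0 := by
  have h := (integrable_exp_neg_mul_sq (b := π / 2) (by positivity)).const_mul (rexp π)
  refine h.mono' f0_continuous.aestronglyMeasurable (Filter.Eventually.of_forall fun t => ?_)
  rw [Real.norm_eq_abs, abs_of_pos (f0_pos t), f0, ← Real.exp_add]
  apply Real.exp_le_exp.2
  have h1 : t ^ 2 / 2 - 1 ≤ (max (|t| - 1) 0) ^ 2 := by
    rw [← sq_abs t]
    rcases le_total (|t| - 1) 0 with h | h
    · rw [max_eq_right h]; nlinarith [abs_nonneg t]
    · rw [max_eq_left h]; nlinarith [sq_nonneg (|t| - 2)]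
  nlinarith [pi_pos]

lemma max_le_abs_sub {a b : ℝ} (hb : |b| ≤ 1) : max (|a| - 1) 0 ≤ |a - b| := by
  refine max_le ?_ (abs_nonneg _)
  have := abs_sub_abs_le_abs_sub a b
  linarith

lemma wills_cube {n : ℕ} :
    wills {x : EuclideanSpace ℝ (Fin n) | ∀ i, x i ∈ Set.Icc (-1 : ℝ) 1} = (∫ t, f0 t) ^ n := by
  have hdist : ∀ x : EuclideanSpace ℝ (Fin n),
      infDist x {x : EuclideanSpace ℝ (Fin n) | ∀ i, x i ∈ Set.Icc (-1 : ℝ) 1} =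
        √(∑ i, (max (|x i| - 1) 0) ^ 2) := by
    intro x
    apply le_antisymm
    · let p : EuclideanSpace ℝ (Fin n) := WithLp.toLp 2 fun i => max (-1) (min 1 (x i))
      have hp : p ∈ {x : EuclideanSpace ℝ (Fin n) | ∀ i, x i ∈ Set.Icc (-1 : ℝ) 1} := by
        intro i
        simp [p]
      refine (infDist_le_dist_of_mem hp).trans_eq ?_
      rw [EuclideanSpace.dist_eq]
      congr 1
      refine Finset.sum_congr rfl fun i _ => ?_
      rw [Real.dist_eq]
      congr 1
      simp only [p]
      rcases le_total 1 (x i) with h | h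
      · rw [min_eq_left h, max_eq_right (by norm_num), abs_of_nonneg (by linarith),
          abs_of_nonneg (by linarith), max_eq_left (by linarith)]
      · rw [min_eq_right h]
        rcases le_total (-1) (x i) with h' | h'
        · rw [max_eq_right h', sub_self, abs_zero, max_eq_right]
          have := abs_le.2 ⟨h', h⟩
          linarith
        · rw [max_eq_left h', abs_of_nonpos (by linarith), abs_of_nonpos (by linarith),
            max_eq_left (by linarith)]
          ring
    · rw [le_infDist ⟨0, by simp⟩]
      intro y hy
      rw [EuclideanSpace.dist_eq]
      refine Real.sqrt_le_sqrt (Finset.sum_le_sum fun i _ => ?_)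
      rw [Real.dist_eq]
      exact pow_le_pow_left₀ (le_max_right _ _) (max_le_abs_sub (abs_le.2 (hy i))) 2
  unfold wills
  have h1 : ∀ x : EuclideanSpace ℝ (Fin n),
      rexp (-π * infDist x {x : EuclideanSpace ℝ (Fin n) | ∀ i, x i ∈ Set.Icc (-1 : ℝ) 1} ^ 2) =
        ∏ i, f0 (x i) := by
    intro x
    rw [hdist, Real.sq_sqrt (Finset.sum_nonneg fun i _ => sq_nonneg _), Finset.mul_sum, Real.exp_sum]
    rfl
  simp only [h1]
  have h2 := (PiLp.volume_preserving_ofLp (Fin n)).integral_comp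
    (MeasurableEquiv.toLp 2 (Fin n → ℝ)).symm.measurableEmbedding (fun y => ∏ i, f0 (y i))
  refine h2.trans ?_
  rw [integral_fintype_prod_volume_eq_pow, Fintype.card_fin]

/-- If `K` is a `0`-symmetric convex body in John position (the unit ball is
contained in `K`, and every ellipsoid, i.e. affine image of the unit ball, contained in `K`
has volume at most that of the unit ball), then `W(K) ≤ W([-1,1]ⁿ)`. -/
theorem wills_john_position {n : ℕ} (K : Set (EuclideanSpace ℝ (Fin n)))
    (hK₁ : IsCompact K) (hK₂ : Convex ℝ K) (hK₃ : K.Nonempty)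
    (hsym : K = -K)
    (hball : Metric.closedBall (0 : EuclideanSpace ℝ (Fin n)) 1 ⊆ K)
    (hJohn : ∀ f : EuclideanSpace ℝ (Fin n) →ᵃ[ℝ] EuclideanSpace ℝ (Fin n),
      f '' Metric.closedBall 0 1 ⊆ K →
        volume (f '' Metric.closedBall 0 1) ≤
          volume (Metric.closedBall (0 : EuclideanSpace ℝ (Fin n)) 1)) :
    wills K ≤ wills {x : EuclideanSpace ℝ (Fin n) | ∀ i, x i ∈ Set.Icc (-1 : ℝ) 1} := by
  obtain ⟨ι, _, c, u, hc, hu, hKu, hdec⟩ := john_decomposition K hK₁ hK₂ hK₃ hball hJohn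
  have hKabs : ∀ i, ∀ k ∈ K, |inner ℝ (u i) k| ≤ 1 := by
    intro i k hk
    have hk' : -k ∈ K := by
      rw [hsym] at hk
      exact hk
    have h1 := hKu i k hk
    have h2 := hKu i (-k) hk'
    rw [inner_neg_right] at h2
    exact abs_le.2 ⟨by linarith, h1⟩
  have hpt : ∀ x, rexp (-π * infDist x K ^ 2) ≤ ∏ i, f0 (inner ℝ (u i) x) ^ c i := by
    intro x
    have h1 : √(∑ i, c i * (max (|inner ℝ (u i) x| - 1) 0) ^ 2) ≤ infDist x K := by
      rw [le_infDist hK₃]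
      intro y hy
      rw [dist_eq_norm]
      refine Real.sqrt_le_iff.2 ⟨norm_nonneg _, ?_⟩
      rw [← dec_norm_sq c u hdec (x - y)]
      refine Finset.sum_le_sum fun i _ => mul_le_mul_of_nonneg_left ?_ (hc i)
      rw [← sq_abs (inner ℝ (u i) (x - y)), inner_sub_right]
      exact pow_le_pow_left₀ (le_max_right _ _) (max_le_abs_sub (hKabs i y hy)) 2
    have h2 := (Real.sqrt_le_iff.1 h1).2
    have h3 : ∏ i, f0 (inner ℝ (u i) x) ^ c i =
        rexp (-π * ∑ i, c i * (max (|inner ℝ (u i) x| - 1) 0) ^ 2) := by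
      rw [Finset.mul_sum, Real.exp_sum]
      refine Finset.prod_congr rfl fun i _ => ?_
      rw [f0, ← Real.exp_mul]
      congr 1
      ring
    rw [h3]
    apply Real.exp_le_exp.2
    nlinarith [pi_pos]
  have hBL := brascamp_lieb c u hc hu hdec f0 f0_continuous f0_pos f0_integrable
  rw [finrank_euclideanSpace_fin] at hBL
  rw [wills_cube, wills, integral_eq_lintegral_of_nonneg_ae
    (Filter.Eventually.of_forall fun x => (Real.exp_pos _).le)
    (Continuous.aestronglyMeasurable (by
      have := continuous_infDist_pt K
      fun_prop))]
  refine ENNReal.toReal_le_of_le_ofReal ?_ ((lintegral_mono fun x => ?_).trans hBL)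
  · exact pow_nonneg (integral_nonneg fun t => (f0_pos t).le) _
  · exact ENNReal.ofReal_le_ofReal (hpt x)
end
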